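/- Let P be the graded permutation operator and Q = P^{t₁}, the partial super-transposition of P in the first factor, with transposition signs θ_a satisfying (-1)^{[a]} θ_a θ_{ā} = θ₀. Then P·Q = Q·P = θ₀ Q and Q² = (M−N) Q. -/

import Mathlib

/-- The ℤ₂-grading: `[a] = 0` for `a ≤ M`, `[a] = 1` for `a > M` (0-indexed). -/
def gr (M N : ℕ) (a : Fin (M + N)) : ℕ := if (a : ℕ) < M then 0 else 1

/-- The index involution `ā`: `ā = M+1-a` for `a ≤ M`, `ā = 2M+N+1-a` for `a > M`
(written 0-indexed). -/
def bar (M N : ℕ) (a : Fin (M + N)) : Fin (M + N) :=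
  if h : (a : ℕ) < M then ⟨M - 1 - (a : ℕ), by omega⟩
  else ⟨2 * M + N - 1 - (a : ℕ), by have := a.isLt; omega⟩

/-- The graded permutation operator `P = Σ_{i,j} (-1)^{[j]} E_{ij} ⊗ E_{ji}`,
as a matrix on the tensor space. -/
noncomputable def Pmat (M N : ℕ) :
    Matrix (Fin (M + N) × Fin (M + N)) (Fin (M + N) × Fin (M + N)) ℂ :=
  fun p q => if p.1 = q.2 ∧ p.2 = q.1
    then (-1 : ℂ) ^ (gr M N q.1 * gr M N q.2) else 0

/-- The partial super-transposition `t₁` in the first tensor factor: it applies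
`E_{ab} ↦ (-1)^{[a]([b]+1)} θ_a θ_b E_{b̄ā}` to the first factor only, with the
Koszul sign of the graded tensor product taken into account. -/
noncomputable def ptransp1 (M N : ℕ) (θ : Fin (M + N) → ℂ)
    (X : Matrix (Fin (M + N) × Fin (M + N)) (Fin (M + N) × Fin (M + N)) ℂ) :
    Matrix (Fin (M + N) × Fin (M + N)) (Fin (M + N) × Fin (M + N)) ℂ :=
  fun p q =>
    ((-1 : ℂ) ^ (gr M N (bar M N q.1) * (gr M N (bar M N p.1) + 1))
        * θ (bar M N q.1) * θ (bar M N p.1))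
      * (-1 : ℂ) ^ ((gr M N p.2 + gr M N q.2)
          * (gr M N (bar M N q.1) + gr M N (bar M N p.1)))
      * X (bar M N q.1, p.2) (bar M N p.1, q.2)

theorem bar_bar (M N : ℕ) (a : Fin (M + N)) : bar M N (bar M N a) = a := by
  have := a.isLt
  by_cases h : (a : ℕ) < M
  · have h' : M - 1 - (a : ℕ) < M := by omega
    simp only [bar, h, h', dif_pos, Fin.ext_iff]
    omega
  · have h' : ¬2 * M + N - 1 - (a : ℕ) < M := by omega
    simp only [bar, h, h', dif_neg, not_false_eq_true, Fin.ext_iff]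
    omega

theorem gr_bar (M N : ℕ) (a : Fin (M + N)) : gr M N (bar M N a) = gr M N a := by
  have := a.isLt
  unfold gr bar
  split_ifs <;> simp_all <;> omega

theorem gr_eq_zero_or_one (M N : ℕ) (a : Fin (M + N)) : gr M N a = 0 ∨ gr M N a = 1 := by
  unfold gr
  split_ifs <;> simp

theorem sum_neg_one_pow_gr (M N : ℕ) :
    ∑ a : Fin (M + N), (-1 : ℂ) ^ gr M N a = (M : ℂ) - N := by
  rw [Fin.sum_univ_add]
  simp [gr, sub_eq_add_neg]

/-- The column vector spanning the range of `Q = P^{t₁}`. -/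
def rangeVec (M N : ℕ) (θ : Fin (M + N) → ℂ) (p : Fin (M + N) × Fin (M + N)) : ℂ :=
  if p.2 = bar M N p.1 then (-1 : ℂ) ^ gr M N p.1 * θ (bar M N p.1) else 0

/-- The row vector whose kernel is the kernel of `Q = P^{t₁}`. -/
def kerVec (M N : ℕ) (θ : Fin (M + N) → ℂ) (q : Fin (M + N) × Fin (M + N)) : ℂ :=
  if q.2 = bar M N q.1 then θ (bar M N q.1) else 0

theorem ptransp1_Pmat (M N : ℕ) (θ : Fin (M + N) → ℂ) :
    ptransp1 M N θ (Pmat M N) = Matrix.vecMulVec (rangeVec M N θ) (kerVec M N θ) := by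
  ext ⟨a, b⟩ ⟨c, d⟩
  simp only [ptransp1, Pmat, Matrix.vecMulVec_apply, rangeVec, kerVec, gr_bar]
  by_cases hb : b = bar M N a
  · by_cases hd : d = bar M N c
    · subst hb hd
      simp only [gr_bar, and_self, if_true]
      rcases gr_eq_zero_or_one M N a with ha | ha <;>
        rcases gr_eq_zero_or_one M N c with hc | hc <;> simp [ha, hc] <;> ring
    · simp [hd, Ne.symm hd]
  · simp [hb]

theorem kerVec_dotProduct_rangeVec (M N : ℕ) (θ : Fin (M + N) → ℂ)
    (hθ : ∀ a, θ a = 1 ∨ θ a = -1) :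
    dotProduct (kerVec M N θ) (rangeVec M N θ) = (M : ℂ) - N := by
  rw [← sum_neg_one_pow_gr, dotProduct, Fintype.sum_prod_type]
  refine Finset.sum_congr rfl fun a _ => ?_
  rw [Finset.sum_eq_single (bar M N a) (fun b _ hb => by simp [kerVec, hb]) (by simp)]
  rcases hθ (bar M N a) with h | h <;> simp [kerVec, rangeVec, h]

theorem Pmat_mulVec_apply (M N : ℕ) (w : Fin (M + N) × Fin (M + N) → ℂ)
    (a b : Fin (M + N)) :
    (Pmat M N).mulVec w (a, b) = (-1 : ℂ) ^ (gr M N a * gr M N b) * w (b, a) := by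
  rw [Matrix.mulVec, dotProduct, Finset.sum_eq_single (b, a)]
  · simp [Pmat, mul_comm (gr M N a)]
  · rintro ⟨c, d⟩ _ h
    have : ¬(a = d ∧ b = c) := by rintro ⟨rfl, rfl⟩; exact h rfl
    simp [Pmat, this]
  · simp

theorem Pmat_transpose (M N : ℕ) : (Pmat M N).transpose = Pmat M N := by
  ext ⟨a, b⟩ ⟨c, d⟩
  simp only [Matrix.transpose_apply, Pmat]
  by_cases h : a = d ∧ b = c
  · obtain ⟨rfl, rfl⟩ := h
    simp [mul_comm]
  · rw [if_neg h, if_neg (fun h' => h ⟨h'.2.symm, h'.1.symm⟩)]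

theorem Pmat_mulVec_rangeVec (M N : ℕ) (θ : Fin (M + N) → ℂ) (θ₀ : ℂ)
    (hθ : ∀ a, θ a = 1 ∨ θ a = -1)
    (hθ₀ : ∀ a, (-1 : ℂ) ^ (gr M N a) * θ a * θ (bar M N a) = θ₀) :
    (Pmat M N).mulVec (rangeVec M N θ) = θ₀ • rangeVec M N θ := by
  ext ⟨a, b⟩
  rw [Pmat_mulVec_apply, Pi.smul_apply, smul_eq_mul, rangeVec, rangeVec, ← hθ₀ a]
  by_cases h : b = bar M N a
  · subst h
    simp only [gr_bar, bar_bar, if_true]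
    rcases gr_eq_zero_or_one M N a with ha | ha <;>
      rcases hθ (bar M N a) with h | h <;> simp [ha, h]
  · have h' : a ≠ bar M N b := by rintro rfl; exact h (bar_bar M N b).symm
    simp [h, h']

theorem kerVec_vecMul_Pmat (M N : ℕ) (θ : Fin (M + N) → ℂ) (θ₀ : ℂ)
    (hθ : ∀ a, θ a = 1 ∨ θ a = -1)
    (hθ₀ : ∀ a, (-1 : ℂ) ^ (gr M N a) * θ a * θ (bar M N a) = θ₀) :
    Matrix.vecMul (kerVec M N θ) (Pmat M N) = θ₀ • kerVec M N θ := by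
  rw [← Pmat_transpose, Matrix.vecMul_transpose]
  ext ⟨a, b⟩
  rw [Pmat_mulVec_apply, Pi.smul_apply, smul_eq_mul, kerVec, kerVec, ← hθ₀ a]
  by_cases h : b = bar M N a
  · subst h
    simp only [gr_bar, bar_bar, if_true]
    rcases gr_eq_zero_or_one M N a with ha | ha <;>
      rcases hθ (bar M N a) with h | h <;> simp [ha, h]
  · have h' : a ≠ bar M N b := by rintro rfl; exact h (bar_bar M N b).symm
    simp [h, h']

/-- with `Q = P^{t₁}` one has `P·Q = Q·P = θ₀ Q` and `Q² = (M−N) Q`. -/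
theorem PQ_relations (M N : ℕ) (θ : Fin (M + N) → ℂ) (θ₀ : ℂ)
    (hθ : ∀ a, θ a = 1 ∨ θ a = -1)
    (hθ₀ : ∀ a, (-1 : ℂ) ^ (gr M N a) * θ a * θ (bar M N a) = θ₀) :
    Pmat M N * ptransp1 M N θ (Pmat M N) = θ₀ • ptransp1 M N θ (Pmat M N)
      ∧ ptransp1 M N θ (Pmat M N) * Pmat M N = θ₀ • ptransp1 M N θ (Pmat M N)
      ∧ ptransp1 M N θ (Pmat M N) * ptransp1 M N θ (Pmat M N)
          = ((M : ℂ) - (N : ℂ)) • ptransp1 M N θ (Pmat M N) := by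
  rw [ptransp1_Pmat]
  refine ⟨?_, ?_, ?_⟩
  · rw [Matrix.mul_vecMulVec, Pmat_mulVec_rangeVec M N θ θ₀ hθ hθ₀, Matrix.smul_vecMulVec]
  · rw [Matrix.vecMulVec_mul, kerVec_vecMul_Pmat M N θ θ₀ hθ hθ₀, Matrix.vecMulVec_smul]
  · rw [Matrix.vecMulVec_mul_vecMulVec, kerVec_dotProduct_rangeVec M N θ hθ,
      Matrix.vecMulVec_smul]
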